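/- For every integer n ≥ 3, set q̄ = 1 + 1/n + 1/n² and define A_n(x, q̄) = (1/(n(n²+n+1)))·( sinh((n+1)²x/n²) + (n²+n+1)·sinh((n²−1)x/n²) − n(n+1)·sinh((n²+1)x/n²) ). Then A_n(0,q̄) = 0, the first and second derivatives of A_n(·,q̄) at 0 vanish, and the third derivative of A_n(·,q̄) at 0 equals 4·(−n⁵ + 3n³ + 5n² + 4n + 1)/(n⁶(n²+n+1)), which is strictly negative. -/

import Mathlib

/-- `A n x = (1/(n(n²+n+1)))·( sinh((n+1)²x/n²) + (n²+n+1)·sinh((n²−1)x/n²)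
  − n(n+1)·sinh((n²+1)x/n²) )`, i.e. `A_n(·, q̄)` for `q̄ = 1 + 1/n + 1/n²`. -/
noncomputable def A (n : ℕ) (x : ℝ) : ℝ :=
  (1 / ((n : ℝ) * ((n : ℝ) ^ 2 + (n : ℝ) + 1))) *
    (Real.sinh (((n : ℝ) + 1) ^ 2 * x / (n : ℝ) ^ 2) +
      ((n : ℝ) ^ 2 + (n : ℝ) + 1) * Real.sinh (((n : ℝ) ^ 2 - 1) * x / (n : ℝ) ^ 2) -
      (n : ℝ) * ((n : ℝ) + 1) * Real.sinh (((n : ℝ) ^ 2 + 1) * x / (n : ℝ) ^ 2))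

theorem sinh_comb_deriv (c p r a b d : ℝ) :
    deriv (fun x : ℝ => c * (Real.sinh (a * x) + p * Real.sinh (b * x) - r * Real.sinh (d * x))) =
    fun x : ℝ => c * (a * Real.cosh (a * x) + p * (b * Real.cosh (b * x))
      - r * (d * Real.cosh (d * x))) := by
  funext x
  have h : ∀ k : ℝ, HasDerivAt (fun x : ℝ => Real.sinh (k * x)) (k * Real.cosh (k * x)) x := by
    intro k
    have := ((hasDerivAt_id x).const_mul k).sinh
    simpa [mul_comm] using this
  exact ((((h a).add ((h b).const_mul p)).sub ((h d).const_mul r)).const_mul c).deriv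

theorem cosh_comb_deriv (c p r a b d : ℝ) :
    deriv (fun x : ℝ => c * (a * Real.cosh (a * x) + p * (b * Real.cosh (b * x))
      - r * (d * Real.cosh (d * x)))) =
    fun x : ℝ => c * a ^ 2 * (Real.sinh (a * x)) + c * p * b ^ 2 * Real.sinh (b * x)
      - c * r * d ^ 2 * Real.sinh (d * x) := by
  funext x
  have h : ∀ k : ℝ, HasDerivAt (fun x : ℝ => k * Real.cosh (k * x))
      (k * (k * Real.sinh (k * x))) x := by
    intro k
    have := (((hasDerivAt_id x).const_mul k).cosh).const_mul k
    simpa [mul_comm] using this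
  have := ((((h a).add ((h b).const_mul p)).sub ((h d).const_mul r)).const_mul c).deriv
  refine Eq.trans this ?_
  ring

theorem sinh_comb_deriv' (c p r a b d : ℝ) :
    deriv (fun x : ℝ => c * (Real.sinh (a * x)) + p * Real.sinh (b * x)
      - r * Real.sinh (d * x)) 0 = c * a + p * b - r * d := by
  have h : ∀ k : ℝ, HasDerivAt (fun x : ℝ => Real.sinh (k * x)) k 0 := by
    intro k
    have := ((hasDerivAt_id (0:ℝ)).const_mul k).sinh
    simpa [mul_comm] using this
  exact ((((h a).const_mul c).add ((h b).const_mul p)).sub ((h d).const_mul r)).deriv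

/-- For `n ≥ 3`: `A n 0 = 0`, the first and second derivatives of `A n` vanish
at `0`, and the third derivative at `0` equals
`4(−n⁵ + 3n³ + 5n² + 4n + 1)/(n⁶(n²+n+1))`, which is strictly negative. -/
theorem A_derivatives_at_zero (n : ℕ) (hn : 3 ≤ n) :
    A n 0 = 0 ∧
    deriv (A n) 0 = 0 ∧
    iteratedDeriv 2 (A n) 0 = 0 ∧
    iteratedDeriv 3 (A n) 0 =
      4 * (-(n : ℝ) ^ 5 + 3 * (n : ℝ) ^ 3 + 5 * (n : ℝ) ^ 2 + 4 * (n : ℝ) + 1) /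
        ((n : ℝ) ^ 6 * ((n : ℝ) ^ 2 + (n : ℝ) + 1)) ∧
    4 * (-(n : ℝ) ^ 5 + 3 * (n : ℝ) ^ 3 + 5 * (n : ℝ) ^ 2 + 4 * (n : ℝ) + 1) /
        ((n : ℝ) ^ 6 * ((n : ℝ) ^ 2 + (n : ℝ) + 1)) < 0 := by
  have hn' : (3 : ℝ) ≤ n := by exact_mod_cast hn
  have hA : A n = fun x : ℝ => (1 / ((n : ℝ) * ((n : ℝ) ^ 2 + (n : ℝ) + 1))) *
      (Real.sinh ((((n : ℝ) + 1) ^ 2 / (n : ℝ) ^ 2) * x) +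
      ((n : ℝ) ^ 2 + (n : ℝ) + 1) * Real.sinh ((((n : ℝ) ^ 2 - 1) / (n : ℝ) ^ 2) * x) -
      ((n : ℝ) * ((n : ℝ) + 1)) * Real.sinh ((((n : ℝ) ^ 2 + 1) / (n : ℝ) ^ 2) * x)) := by
    funext x
    simp only [A, div_mul_eq_mul_div]
  have h0 : (n : ℝ) ≠ 0 := by positivity
  have h1 : (n : ℝ) ^ 2 + (n : ℝ) + 1 ≠ 0 := by positivity
  refine ⟨by simp [A], ?_, ?_, ?_, ?_⟩
  · rw [hA, sinh_comb_deriv]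
    simp only [mul_zero, Real.cosh_zero]
    field_simp
    ring
  · rw [hA, iteratedDeriv_succ, iteratedDeriv_one, sinh_comb_deriv, cosh_comb_deriv]
    simp
  · rw [hA, iteratedDeriv_succ, iteratedDeriv_succ, iteratedDeriv_one, sinh_comb_deriv,
      cosh_comb_deriv, sinh_comb_deriv']
    field_simp
    ring
  · apply div_neg_of_neg_of_pos
    · obtain ⟨t, ht⟩ : ∃ t : ℝ, (n : ℝ) = t + 3 := ⟨n - 3, by ring⟩
      have ht0 : 0 ≤ t := by linarith
      rw [ht]
      have e : 4 * (-(t + 3) ^ 5 + 3 * (t + 3) ^ 3 + 5 * (t + 3) ^ 2 + 4 * (t + 3) + 1)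
        = -(4 * (t ^ 5 + 15 * t ^ 4 + 87 * t ^ 3 + 238 * t ^ 2 + 290 * t + 104)) := by ring
      rw [e]
      have : 0 < 4 * (t ^ 5 + 15 * t ^ 4 + 87 * t ^ 3 + 238 * t ^ 2 + 290 * t + 104) := by
        positivity
      linarith
    · positivity
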